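/- Let $k, m \in \mathbb{N}$ with $k$ and $m$ even, and let $h_1, \ldots, h_m \in \mathbb{Z}$ with $h_1$ odd and $\gcd(h_j,k)=1$ for all $j$, with inverses $h_j'$ mod $k$. Then $\sum_{a_1+\cdots+a_m \equiv 0 \pmod k} (-1)^{a_1} ((a_1 h_1/k)) \cdots ((a_m h_m/k)) = \frac{(-1)^{m/2-1}}{2^m k} \sum_{1 \le a \le k-1, a \ne k/2} \tan(\pi a h_1'/k) \cot(\pi a h_2'/k) \cdots \cot(\pi a h_m'/k)$. -/

import Mathlib

open scoped Classical

/-- The sawtooth function `((x))`. -/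
noncomputable def saw (x : ℝ) : ℝ :=
  if ∃ m : ℤ, x = m then 0 else Int.fract x - 1 / 2

/-- The cotangent function. -/
noncomputable def cot (x : ℝ) : ℝ := Real.cos x / Real.sin x

lemma saw_add_int (x : ℝ) (n : ℤ) : saw (x + n) = saw x := by
  have : (∃ m : ℤ, x + n = m) ↔ ∃ m : ℤ, x = m := by
    constructor
    · rintro ⟨m, hm⟩
      exact ⟨m - n, by push_cast; linarith⟩
    · rintro ⟨m, hm⟩
      exact ⟨m + n, by push_cast; linarith⟩
  simp only [saw, this, Int.fract_add_intCast]

lemma saw_zero : saw 0 = 0 := if_pos ⟨0, by simp⟩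

lemma saw_div_of_pos_of_lt {a k : ℕ} (ha : 0 < a) (hak : a < k) :
    saw ((a : ℝ) / k) = a / k - 1 / 2 := by
  have hk : (0 : ℝ) < k := by exact_mod_cast ha.trans hak
  have h0 : (0 : ℝ) < a / k := div_pos (by exact_mod_cast ha) hk
  have h1 : (a : ℝ) / k < 1 := (div_lt_one hk).2 (by exact_mod_cast hak)
  rw [saw, if_neg, Int.fract_eq_self.2 ⟨h0.le, h1⟩]
  rintro ⟨m, hm⟩
  rw [hm] at h0 h1
  have h0' : 0 < m := by exact_mod_cast h0
  have h1' : m < 1 := by exact_mod_cast h1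
  omega

lemma saw_div_of_lt {a k : ℕ} (hak : a < k) :
    saw ((a : ℝ) / k) = (a : ℝ) / k - 1 / 2 + if a = 0 then 1 / 2 else 0 := by
  rcases Nat.eq_zero_or_pos a with rfl | ha
  · simp [saw_zero]
  · simp [saw_div_of_pos_of_lt ha hak, ha.ne']

lemma sum_range_mul_pow_mul_sub_one (ω : ℂ) (n : ℕ) :
    (∑ a ∈ Finset.range n, (a : ℂ) * ω ^ a) * (ω - 1) =
      n * ω ^ n - ∑ a ∈ Finset.range n, ω ^ (a + 1) := by
  induction n with
  | zero => simp
  | succ n ih =>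
    rw [Finset.sum_range_succ, Finset.sum_range_succ, add_mul, ih]
    push_cast
    ring

lemma sum_saw_mul_pow_of_ne_one {k : ℕ} (hk : 0 < k) {ω : ℂ} (hω : ω ^ k = 1) (h1 : ω ≠ 1) :
    (∑ a ∈ Finset.range k, (saw ((a : ℝ) / k) : ℂ) * ω ^ a) * (2 * (ω - 1)) = ω + 1 := by
  have hgeom : ∑ a ∈ Finset.range k, ω ^ a = 0 := by
    rw [geom_sum_eq h1, hω, sub_self, zero_div]
  have hlin := sum_range_mul_pow_mul_sub_one ω k
  simp only [pow_succ, ← Finset.sum_mul, hgeom, hω] at hlin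
  have hk' : (k : ℂ) ≠ 0 := by exact_mod_cast hk.ne'
  have hsum : ∑ a ∈ Finset.range k, (saw ((a : ℝ) / k) : ℂ) * ω ^ a =
      (∑ a ∈ Finset.range k, (a : ℂ) * ω ^ a) / k -
        1 / 2 * ∑ a ∈ Finset.range k, ω ^ a + 1 / 2 := by
    have hterm : ∀ a ∈ Finset.range k, (saw ((a : ℝ) / k) : ℂ) * ω ^ a =
        a * ω ^ a / k - 1 / 2 * ω ^ a + if a = 0 then 1 / 2 else 0 := by
      intro a ha
      rw [saw_div_of_lt (Finset.mem_range.1 ha)]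
      split_ifs with h
      · simp [h]
      · push_cast
        ring
    rw [Finset.sum_congr rfl hterm, Finset.sum_add_distrib, Finset.sum_sub_distrib,
      ← Finset.sum_div, ← Finset.mul_sum]
    simp [hk]
  rw [hsum, hgeom]
  field_simp
  linear_combination 2 * hlin

lemma sum_saw_div (k : ℕ) : ∑ a ∈ Finset.range k, saw ((a : ℝ) / k) = 0 := by
  rcases Nat.eq_zero_or_pos k with rfl | hk
  · simp
  have hk' : (k : ℝ) ≠ 0 := by exact_mod_cast hk.ne'
  have hg : ∀ n : ℕ, ∑ a ∈ Finset.range n, (a : ℝ) = n * (n - 1) / 2 := by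
    intro n
    induction n with
    | zero => simp
    | succ n ih => rw [Finset.sum_range_succ, ih]; push_cast; ring
  rw [Finset.sum_congr rfl fun a ha => saw_div_of_lt (Finset.mem_range.1 ha),
    Finset.sum_add_distrib, Finset.sum_sub_distrib, ← Finset.sum_div, hg]
  simp [hk]
  field_simp
  ring

/-- The additive character `n ↦ exp (2πi n / k)`. -/
noncomputable def rootExp (k : ℕ) (n : ℤ) : ℂ := Complex.exp (2 * Real.pi * Complex.I / k) ^ n

lemma rootExp_add (k : ℕ) (m n : ℤ) : rootExp k (m + n) = rootExp k m * rootExp k n :=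
  zpow_add₀ (Complex.exp_ne_zero _) _ _

lemma rootExp_mul_natCast (k : ℕ) (n : ℤ) (a : ℕ) : rootExp k (n * a) = rootExp k n ^ a := by
  simp only [rootExp, zpow_mul, zpow_natCast]

lemma rootExp_eq_one_iff {k : ℕ} (hk : 0 < k) (n : ℤ) : rootExp k n = 1 ↔ (k : ℤ) ∣ n :=
  (Complex.isPrimitiveRoot_exp k hk.ne').zpow_eq_one_iff_dvd n

lemma rootExp_congr {k : ℕ} (hk : 0 < k) {m n : ℤ} (hmn : m ≡ n [ZMOD k]) :
    rootExp k m = rootExp k n := by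
  have h := (rootExp_eq_one_iff hk (m - n)).2 hmn.symm.dvd
  rw [← sub_add_cancel m n, rootExp_add, h, one_mul]

lemma rootExp_eq_sq (k : ℕ) (n : ℤ) :
    rootExp k n = (Real.cos (Real.pi * n / k) + Real.sin (Real.pi * n / k) * Complex.I) ^ 2 := by
  rw [rootExp, ← Complex.exp_int_mul, Complex.ofReal_cos, Complex.ofReal_sin,
    ← Complex.exp_mul_I, ← Complex.exp_nat_mul]
  congr 1
  push_cast
  ring

lemma rootExp_half_mul {k : ℕ} (hk : 0 < k) (hke : Even k) (a : ℕ) :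
    rootExp k ((k / 2 : ℕ) * a) = (-1) ^ a := by
  obtain ⟨t, rfl⟩ := hke
  have ht : (t : ℝ) ≠ 0 := by
    have : t ≠ 0 := by omega
    exact_mod_cast this
  rw [rootExp_mul_natCast, rootExp_eq_sq]
  have h2 : (t + t) / 2 = t := by omega
  have : Real.pi * ((t : ℕ) : ℤ) / ((t + t : ℕ) : ℝ) = Real.pi / 2 := by
    push_cast
    field_simp
    ring
  rw [h2, this]
  simp

lemma sum_rootExp_mul {k : ℕ} (hk : 0 < k) (n : ℤ) :
    ∑ b ∈ Finset.range k, rootExp k (n * b) = if (k : ℤ) ∣ n then (k : ℂ) else 0 := by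
  simp only [rootExp_mul_natCast]
  split_ifs with h
  · simp [(rootExp_eq_one_iff hk n).2 h]
  · rw [geom_sum_eq (mt (rootExp_eq_one_iff hk n).1 h), ← rootExp_mul_natCast,
      (rootExp_eq_one_iff hk _).2 (dvd_mul_left _ _), sub_self, zero_div]

/-- The discrete Fourier transform of the sawtooth function. -/
lemma sum_saw_mul_rootExp {k : ℕ} (hk : 0 < k) (n : ℤ) :
    ∑ a ∈ Finset.range k, (saw ((a : ℝ) / k) : ℂ) * rootExp k (n * a) =
      -(Complex.I / 2) * cot (Real.pi * n / k) := by
  simp only [rootExp_mul_natCast]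
  have hsq := rootExp_eq_sq k n
  by_cases h : rootExp k n = 1
  · have hk' : (k : ℝ) ≠ 0 := by exact_mod_cast hk.ne'
    obtain ⟨t, rfl⟩ := (rootExp_eq_one_iff hk n).1 h
    have hs : Real.sin (Real.pi * ((k * t : ℤ) : ℝ) / k) = 0 := by
      rw [← Real.sin_int_mul_pi t]
      congr 1
      push_cast
      field_simp
    rw [cot, hs, h]
    simp only [one_pow, mul_one, ← Complex.ofReal_sum, sum_saw_div]
    simp
  · have hω : rootExp k n ^ k = 1 := by
      rw [← rootExp_mul_natCast, rootExp_eq_one_iff hk]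
      exact dvd_mul_left _ _
    have hS := sum_saw_mul_pow_of_ne_one hk hω h
    generalize (∑ a ∈ Finset.range k, (saw ((a : ℝ) / k) : ℂ) * rootExp k n ^ a) = S at *
    have hcs : ((Real.cos (Real.pi * n / k) : ℝ) : ℂ) ^ 2 +
        ((Real.sin (Real.pi * n / k) : ℝ) : ℂ) ^ 2 = 1 := by
      exact_mod_cast Real.cos_sq_add_sin_sq _
    rw [cot]
    push_cast [-Complex.ofReal_cos, -Complex.ofReal_sin]
    generalize ((Real.cos (Real.pi * n / k) : ℝ) : ℂ) = c at *
    generalize ((Real.sin (Real.pi * n / k) : ℝ) : ℂ) = s at *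
    have hI := Complex.I_sq
    have hs : s ≠ 0 := by
      rintro rfl
      apply h
      rw [hsq]
      linear_combination hcs
    have hunit : (c + s * Complex.I) ≠ 0 := by
      intro h0
      have : (c + s * Complex.I) * (c - s * Complex.I) = 1 := by
        linear_combination hcs - s ^ 2 * hI
      simp [h0] at this
    have h1 : rootExp k n - 1 = 2 * Complex.I * s * (c + s * Complex.I) := by
      rw [hsq]
      linear_combination hcs - s ^ 2 * hI
    have h2 : rootExp k n + 1 = 2 * c * (c + s * Complex.I) := by
      rw [hsq]
      linear_combination -hcs + s ^ 2 * hI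
    rw [h1, h2] at hS
    have hS' : S * (2 * Complex.I * s) = c := by
      apply mul_right_cancel₀ (mul_ne_zero two_ne_zero hunit)
      linear_combination hS
    field_simp
    linear_combination -Complex.I * hS' + 2 * S * s * hI

lemma sum_range_mul_eq_of_periodic {k : ℕ} (hk : 0 < k) {G : ℤ → ℂ}
    (hG : ∀ m n : ℤ, m ≡ n [ZMOD k] → G m = G n) {h h' : ℤ} (hinv : h * h' ≡ 1 [ZMOD k]) :
    ∑ a ∈ Finset.range k, G (a * h) = ∑ a ∈ Finset.range k, G a := by
  have hk' : (0 : ℤ) < k := by exact_mod_cast hk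
  have hcast : ∀ n : ℤ, (((n % k).toNat : ℕ) : ℤ) = n % k := fun n =>
    Int.toNat_of_nonneg (Int.emod_nonneg _ hk'.ne')
  have hlt : ∀ n : ℤ, (n % k).toNat ∈ Finset.range k := by
    intro n
    rw [Finset.mem_range, ← Int.ofNat_lt, hcast]
    exact Int.emod_lt_of_pos _ hk'
  have hround : ∀ u v : ℤ, u * v ≡ 1 [ZMOD k] → ∀ a ∈ Finset.range k,
      (((((a * u : ℤ) % k).toNat : ℕ) * v : ℤ) % k).toNat = a := by
    intro u v huv a ha
    have : (((a * u : ℤ) % k) * v) % k = a := by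
      have h1 : ((a * u : ℤ) % k) * v ≡ a [ZMOD k] := by
        calc ((a * u : ℤ) % k) * v ≡ a * u * v [ZMOD k] := (Int.mod_modEq _ _).mul_right _
          _ = a * (u * v) := by ring
          _ ≡ a * 1 [ZMOD k] := huv.mul_left _
          _ = a := mul_one _
      rw [h1.eq]
      exact Int.emod_eq_of_lt (by positivity) (by exact_mod_cast Finset.mem_range.1 ha)
    rw [hcast, this, Int.toNat_natCast]
  refine Finset.sum_nbij' (fun a => ((a * h : ℤ) % k).toNat) (fun a => ((a * h' : ℤ) % k).toNat)
    (fun a _ => hlt _) (fun a _ => hlt _) (hround _ _ hinv)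
    (hround _ _ (by rwa [mul_comm])) fun a _ => hG _ _ ?_
  rw [hcast]
  exact (Int.mod_modEq _ _).symm

lemma saw_intCast_div_congr {k : ℕ} (hk : 0 < k) {m n : ℤ} (hmn : m ≡ n [ZMOD k]) :
    saw ((m : ℝ) / k) = saw ((n : ℝ) / k) := by
  have hk' : (k : ℝ) ≠ 0 := by exact_mod_cast hk.ne'
  obtain ⟨t, ht⟩ := hmn.symm.dvd
  have hm : m = n + k * t := by linarith
  rw [← saw_add_int ((n : ℝ) / k) t, hm]
  congr 1
  push_cast
  field_simp

lemma sum_saw_mul_int_mul_rootExp {k : ℕ} (hk : 0 < k) {h h' : ℤ} (hinv : h * h' ≡ 1 [ZMOD k])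
    (c : ℤ) :
    ∑ a ∈ Finset.range k, (saw ((a : ℝ) * h / k) : ℂ) * rootExp k (c * a) =
      -(Complex.I / 2) * cot (Real.pi * c * h' / k) := by
  have hdft := sum_saw_mul_rootExp hk (c * h')
  have hper := sum_range_mul_eq_of_periodic hk
    (G := fun n => (saw ((n : ℝ) / k) : ℂ) * rootExp k (c * h' * n))
    (fun m n hmn => by
      simp only [saw_intCast_div_congr hk hmn, rootExp_congr hk (hmn.mul_left (c * h'))]) hinv
  simp only [Int.cast_natCast] at hper
  rw [hdft] at hper
  rw [mul_assoc Real.pi, ← Int.cast_mul, ← hper]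
  refine Finset.sum_congr rfl fun a _ => ?_
  have hc : c * a ≡ c * h' * (a * h) [ZMOD k] := by
    calc c * a = c * a * 1 := by ring
      _ ≡ c * a * (h * h') [ZMOD k] := hinv.symm.mul_left _
      _ = c * h' * (a * h) := by ring
  rw [rootExp_congr hk hc]
  push_cast
  rfl

lemma cot_add_odd_mul_pi_div_two (x : ℝ) {n : ℤ} (hn : Odd n) :
    cot (x + n * (Real.pi / 2)) = -Real.tan x := by
  obtain ⟨t, rfl⟩ := hn
  have : x + ((2 * t + 1 : ℤ) : ℝ) * (Real.pi / 2) = x + Real.pi / 2 + t * Real.pi := by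
    push_cast
    ring
  rw [cot, this, Real.cos_add_int_mul_pi, Real.sin_add_int_mul_pi, Real.cos_add_pi_div_two,
    Real.sin_add_pi_div_two, mul_div_mul_left _ _ (zpow_ne_zero _ (by norm_num)), neg_div,
    Real.tan_eq_sin_div_cos]

lemma odd_of_mul_modEq_one {k : ℕ} (hke : Even k) {h h' : ℤ} (hinv : h * h' ≡ 1 [ZMOD k]) :
    Odd h' := by
  obtain ⟨s, hs⟩ := hinv.dvd
  obtain ⟨t, rfl⟩ := hke
  by_contra hev
  obtain ⟨r, rfl⟩ := Int.not_odd_iff_even.1 hev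
  have : (1 : ℤ) = 2 * (h * r + t * s) := by
    push_cast at hs
    linear_combination hs
  omega

lemma sum_neg_one_pow_mul_saw_mul_rootExp {k : ℕ} (hk : 0 < k) (hke : Even k) {h h' : ℤ}
    (hinv : h * h' ≡ 1 [ZMOD k]) (c : ℤ) :
    ∑ a ∈ Finset.range k, (-1) ^ a * (saw ((a : ℝ) * h / k) : ℂ) * rootExp k (c * a) =
      Complex.I / 2 * Real.tan (Real.pi * c * h' / k) := by
  have hk' : (k : ℝ) ≠ 0 := by exact_mod_cast hk.ne'
  have hodd := odd_of_mul_modEq_one hke hinv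
  have key := sum_saw_mul_int_mul_rootExp hk hinv (c + (k / 2 : ℕ))
  have harg : Real.pi * ((c + (k / 2 : ℕ) : ℤ) : ℝ) * h' / k =
      Real.pi * c * h' / k + h' * (Real.pi / 2) := by
    rw [Int.cast_add, Int.cast_natCast, Nat.cast_div hke.two_dvd (by norm_num), Nat.cast_ofNat]
    field_simp
  rw [harg, cot_add_odd_mul_pi_div_two _ hodd] at key
  simp only [add_mul, rootExp_add, rootExp_half_mul hk hke] at key
  rw [show Complex.I / 2 * (Real.tan (Real.pi * c * h' / k) : ℂ) =
    -(Complex.I / 2) * ((-Real.tan (Real.pi * c * h' / k) : ℝ) : ℂ) by push_cast; ring, ← key]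
  exact Finset.sum_congr rfl fun a _ => by ring

lemma rootExp_sum {ι : Type*} (k : ℕ) (s : Finset ι) (f : ι → ℤ) :
    rootExp k (∑ j ∈ s, f j) = ∏ j ∈ s, rootExp k (f j) := by
  induction s using Finset.induction_on with
  | empty => simp [rootExp]
  | insert j s hj ih => rw [Finset.sum_insert hj, Finset.prod_insert hj, rootExp_add, ih]

lemma mul_sum_filter_prod_eq {k m : ℕ} (hk : 0 < k) (f : Fin m → ℕ → ℂ) :
    (k : ℂ) * ∑ a ∈ Finset.univ.filter (fun a : Fin m → Fin k => (∑ j, (a j : ℕ)) % k = 0),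
        ∏ j, f j (a j) =
      ∑ b ∈ Finset.range k, ∏ j, ∑ a ∈ Finset.range k, f j a * rootExp k (b * a) := by
  have hexp : ∀ b : ℕ, ∏ j, ∑ a ∈ Finset.range k, f j a * rootExp k (b * a) =
      ∑ a : Fin m → Fin k, (∏ j, f j (a j)) * rootExp k ((∑ j, (a j : ℕ) : ℕ) * b) := by
    intro b
    simp only [← Fin.sum_univ_eq_sum_range fun a => f _ a * rootExp k (b * a)]
    rw [Finset.prod_univ_sum, Fintype.piFinset_univ]
    refine Finset.sum_congr rfl fun a _ => ?_
    rw [Finset.prod_mul_distrib, ← rootExp_sum, ← Finset.mul_sum]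
    push_cast
    rw [mul_comm (b : ℤ)]
  simp only [hexp]
  rw [Finset.sum_comm, Finset.mul_sum, Finset.sum_filter]
  refine Finset.sum_congr rfl fun a _ => ?_
  rw [← Finset.mul_sum, sum_rootExp_mul hk]
  simp only [Int.natCast_dvd_natCast, Nat.dvd_iff_mod_eq_zero]
  split_ifs <;> ring

theorem hardy_A_higher (k m : ℕ) (hk : 0 < k) (hke : Even k) (hm : 0 < m) (hme : Even m)
    (h h' : Fin m → ℤ) (hodd : Odd (h ⟨0, hm⟩)) (hco : ∀ j, Int.gcd (h j) k = 1)
    (hinv : ∀ j, h j * h' j ≡ 1 [ZMOD (k : ℤ)]) :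
    ∑ a ∈ Finset.univ.filter (fun a : Fin m → Fin k => (∑ j, (a j : ℕ)) % k = 0),
        (-1 : ℝ) ^ (a ⟨0, hm⟩ : ℕ) * ∏ j, saw ((a j : ℕ) * (h j : ℝ) / k)
      = (-1 : ℝ) ^ (m / 2 - 1) / (2 ^ m * k) *
          ∑ a ∈ (Finset.Icc 1 (k - 1)).filter (fun a => a ≠ k / 2),
            Real.tan (Real.pi * a * (h' ⟨0, hm⟩ : ℝ) / k) *
              ∏ j ∈ Finset.univ.erase ⟨0, hm⟩, cot (Real.pi * a * (h' j : ℝ) / k) := by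
  have hkR : (k : ℝ) ≠ 0 := by exact_mod_cast hk.ne'
  set j₀ : Fin m := ⟨0, hm⟩ with hj₀
  set T : ℕ → ℝ := fun a => Real.tan (Real.pi * a * (h' j₀ : ℝ) / k) *
    ∏ j ∈ Finset.univ.erase j₀, cot (Real.pi * a * (h' j : ℝ) / k) with hT
  have hT_zero : T 0 = 0 := by simp [hT]
  have hT_half : T (k / 2) = 0 := by
    have : Real.cos (Real.pi * (k / 2 : ℕ) * (h' j₀ : ℝ) / k) = 0 := by
      have harg : Real.pi * (k / 2 : ℕ) * (h' j₀ : ℝ) / k = h' j₀ * (Real.pi / 2) := by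
        rw [Nat.cast_div hke.two_dvd (by norm_num)]
        push_cast
        field_simp
      obtain ⟨t, ht⟩ := odd_of_mul_modEq_one hke (hinv j₀)
      rw [harg, ht, Real.cos_eq_zero_iff]
      exact ⟨t, by push_cast; ring⟩
    simp [hT, Real.tan_eq_sin_div_cos, this]
  have hrange : ∑ a ∈ (Finset.Icc 1 (k - 1)).filter (fun a => a ≠ k / 2), T a =
      ∑ a ∈ Finset.range k, T a := by
    refine Finset.sum_subset (fun a ha => ?_) fun a ha hna => ?_
    · simp only [Finset.mem_filter, Finset.mem_Icc, Finset.mem_range] at ha ⊢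
      omega
    · simp only [Finset.mem_filter, Finset.mem_Icc, Finset.mem_range] at ha hna
      rcases Nat.eq_zero_or_pos a with rfl | hpos
      · exact hT_zero
      · have : a = k / 2 := by
          by_contra hne
          exact hna ⟨⟨hpos, by omega⟩, hne⟩
        rw [this, hT_half]
  rw [hrange]
  have hsign : Complex.I / 2 * (-(Complex.I / 2)) ^ (m - 1) =
      (-1) ^ (m / 2 - 1) / 2 ^ m := by
    obtain ⟨t, rfl⟩ := hme
    obtain ⟨s, rfl⟩ : ∃ s, t = s + 1 := ⟨t - 1, by omega⟩
    have h1 : (s + 1 + (s + 1)) / 2 - 1 = s := by omega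
    have h2 : s + 1 + (s + 1) - 1 = 2 * s + 1 := by omega
    rw [h1, h2, pow_succ, pow_mul]
    have h3 : (-(Complex.I / 2)) ^ 2 = -1 / 2 ^ 2 := by
      linear_combination Complex.I_sq / 4
    rw [h3, div_pow, ← pow_mul, show s + 1 + (s + 1) = 2 * s + 2 by ring, pow_add]
    field_simp
    linear_combination -Complex.I_sq
  set f : Fin m → ℕ → ℂ := fun j a =>
    (if j = j₀ then (-1) ^ a else 1) * (saw ((a : ℝ) * h j / k) : ℂ) with hf
  have hfactor : ∀ b : ℕ, ∏ j, ∑ a ∈ Finset.range k, f j a * rootExp k (b * a) =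
      (-1) ^ (m / 2 - 1) / 2 ^ m * (T b : ℂ) := by
    intro b
    rw [← Finset.mul_prod_erase _ _ (Finset.mem_univ j₀)]
    have h0 := sum_neg_one_pow_mul_saw_mul_rootExp hk hke (hinv j₀) b
    have hj : ∀ j ∈ Finset.univ.erase j₀, ∑ a ∈ Finset.range k, f j a * rootExp k (b * a) =
        -(Complex.I / 2) * cot (Real.pi * b * h' j / k) := by
      intro j hj
      have := sum_saw_mul_int_mul_rootExp hk (hinv j) b
      simpa [hf, Finset.ne_of_mem_erase hj] using this
    rw [Finset.prod_congr rfl hj, Finset.prod_mul_distrib, Finset.prod_const,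
      Finset.card_erase_of_mem (Finset.mem_univ _), Finset.card_univ, Fintype.card_fin]
    simp only [hf, if_true]
    rw [h0, ← hsign, hT]
    push_cast
    ring
  have key := mul_sum_filter_prod_eq hk f
  simp only [hfactor] at key
  have hfprod : ∀ a : Fin m → Fin k, ∏ j, f j (a j) =
      (((-1 : ℝ) ^ (a j₀ : ℕ) * ∏ j, saw ((a j : ℕ) * (h j : ℝ) / k) : ℝ) : ℂ) := by
    intro a
    simp only [hf, Finset.prod_mul_distrib, Finset.prod_ite_eq', Finset.mem_univ, if_true]
    push_cast
    rfl
  simp only [hfprod, ← Finset.mul_sum] at key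
  have key' : (k : ℝ) * ∑ a ∈ Finset.univ.filter
      (fun a : Fin m → Fin k => (∑ j, (a j : ℕ)) % k = 0),
        (-1 : ℝ) ^ (a j₀ : ℕ) * ∏ j, saw ((a j : ℕ) * (h j : ℝ) / k) =
      (-1) ^ (m / 2 - 1) / 2 ^ m * ∑ b ∈ Finset.range k, T b := by
    exact_mod_cast key
  apply mul_left_cancel₀ hkR
  rw [key']
  field_simp
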